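/- arXiv:2401.04847 — 7 statements merged into one kernel-verified Lean document; each statement's English description precedes it below -/
import Mathlib

section
/- Suppose g* ∈ I_X minimizes J_X(g, ·) over I_X. Let c ∈ ℝ and suppose the level set [g* = c] = {x ∈ X : g*(x) = c} is nonempty. Then c ∈ Cf_g([g* = c]), i.e., c minimizes the function y ↦ Σ_{x∈[g*=c]} ℓ(g(x), y) over ℝ. -/
open Pointwise Finset
open scoped Classical

variable {X : Type*}

/-- `f` is isotonic on the subset `S` of `X`. -/
def IsotonicOn [PartialOrder X] (f : X → ℝ) (S : Finset X) : Prop :=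
  ∀ x ∈ S, ∀ y ∈ S, x ≤ y → f x ≤ f y

/-- The separable loss `J_S(g, f) = Σ_{x∈S} ℓ(g(x), f(x))`. -/
noncomputable def lossJ (ℓ : ℝ → ℝ → ℝ) (g : X → ℝ) (S : Finset X) (f : X → ℝ) : ℝ :=
  ∑ x ∈ S, ℓ (g x) (f x)

/-- The subdifferential of the convex function `ℓ(a, ·)` at `b`. -/
def subdiff (ℓ : ℝ → ℝ → ℝ) (a b : ℝ) : Set ℝ :=
  {s : ℝ | ∀ y : ℝ, ℓ a b + s * (y - b) ≤ ℓ a y}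

/-- `Σ_b(S) = −Σ_{x∈S} ∂ℓ(g(x), b)` (Minkowski sum; `Σ_b(∅) = {0}`). -/
noncomputable def SigmaSet (ℓ : ℝ → ℝ → ℝ) (g : X → ℝ) (b : ℝ) (S : Finset X) : Set ℝ :=
  -∑ x ∈ S, subdiff ℓ (g x) b

/-- `U` is an upper set of `X`. -/
def IsUpperFinset [PartialOrder X] (U : Finset X) : Prop :=
  ∀ x ∈ U, ∀ y : X, x ≤ y → y ∈ U

/-- `L` is a lower set of `X`. -/
def IsLowerFinset [PartialOrder X] (L : Finset X) : Prop :=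
  ∀ y ∈ L, ∀ x : X, x ≤ y → x ∈ L

/-- `U` is a maximal upper set with respect to `b`:
it maximizes `min Σ_b(U')` over all upper sets `U'`. -/
def IsMaxUpper [PartialOrder X] (ℓ : ℝ → ℝ → ℝ) (g : X → ℝ) (b : ℝ) (U : Finset X) : Prop :=
  IsUpperFinset U ∧ ∀ U' : Finset X, IsUpperFinset U' →
    sInf (SigmaSet ℓ g b U') ≤ sInf (SigmaSet ℓ g b U)

/-- `L` is a minimal lower set with respect to `b`:
it minimizes `max Σ_b(L')` over all lower sets `L'`. -/
def IsMinLower [PartialOrder X] (ℓ : ℝ → ℝ → ℝ) (g : X → ℝ) (b : ℝ) (L : Finset X) : Prop :=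
  IsLowerFinset L ∧ ∀ L' : Finset X, IsLowerFinset L' →
    sSup (SigmaSet ℓ g b L) ≤ sSup (SigmaSet ℓ g b L')

/-- Moving the value of an isotonic function on a level set, without crossing the other values,
preserves isotonicity. -/
theorem IsotonicOn.update_level_set [PartialOrder X] {f : X → ℝ} {S : Finset X} {c y : ℝ}
    (hf : IsotonicOn f S) (hlt : ∀ x, f x < c → f x ≤ y) (hgt : ∀ x, c < f x → y ≤ f x) :
    IsotonicOn (fun x => if f x = c then y else f x) S := by
  intro a ha b hb hab
  have hfab := hf a ha b hb hab
  dsimp only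
  split_ifs with h1 h2 h2
  · exact le_rfl
  · exact hgt b (lt_of_le_of_ne (h1 ▸ hfab) (Ne.symm h2))
  · exact hlt a (lt_of_le_of_ne (h2 ▸ hfab) h1)
  · exact hfab

/-- Values close enough to `c` do not cross the other values of a function on a finite type. -/
theorem eventually_nhds_not_cross [Finite X] (f : X → ℝ) (c : ℝ) :
    ∀ᶠ y in nhds c, ∀ x, (f x < c → f x ≤ y) ∧ (c < f x → y ≤ f x) := by
  refine Filter.eventually_all.2 fun x => ?_
  rcases lt_trichotomy (f x) c with h | h | h
  · filter_upwards [eventually_gt_nhds h] with y hy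
    exact ⟨fun _ => hy.le, fun h' => absurd h' h.not_gt⟩
  · simp [h]
  · filter_upwards [eventually_lt_nhds h] with y hy
    exact ⟨fun h' => absurd h' h.not_gt, fun _ => hy.le⟩

/-- If `g*` minimizes `J_X(g, ·)` over `I_X` and the level set
`[g* = c]` is nonempty, then `c` minimizes `y ↦ Σ_{x ∈ [g*=c]} ℓ(g(x), y)` over `ℝ`. -/
theorem constant_fit_on_level_set
    [Fintype X] [Nonempty X] [PartialOrder X]
    (ℓ : ℝ → ℝ → ℝ) (hconv : ∀ a : ℝ, ConvexOn ℝ (Set.univ : Set ℝ) (ℓ a))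
    (g gstar : X → ℝ)
    (hiso : IsotonicOn gstar Finset.univ)
    (hmin : ∀ h : X → ℝ, IsotonicOn h Finset.univ →
      lossJ ℓ g Finset.univ gstar ≤ lossJ ℓ g Finset.univ h)
    (c : ℝ) (hne : (Finset.univ.filter (fun x => gstar x = c)).Nonempty) :
    ∀ y : ℝ,
      ∑ x ∈ Finset.univ.filter (fun x => gstar x = c), ℓ (g x) c ≤
      ∑ x ∈ Finset.univ.filter (fun x => gstar x = c), ℓ (g x) y := by
  have hlocal : IsLocalMin
      (fun y => ∑ x ∈ Finset.univ.filter (fun x => gstar x = c), ℓ (g x) y) c := by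
    filter_upwards [eventually_nhds_not_cross gstar c] with y hy
    have h := hmin _ (hiso.update_level_set (fun x => (hy x).1) (fun x => (hy x).2))
    unfold lossJ at h
    rw [← Finset.sum_filter_add_sum_filter_not _ (fun x => gstar x = c),
      ← Finset.sum_filter_add_sum_filter_not Finset.univ (fun x => gstar x = c)
        (fun x => ℓ (g x) (if gstar x = c then y else gstar x))] at h
    have hlevel (z : X → ℝ) (w : ℝ) (hz : ∀ x, gstar x = c → z x = w) :
        ∑ x ∈ Finset.univ.filter (fun x => gstar x = c), ℓ (g x) (z x) =
          ∑ x ∈ Finset.univ.filter (fun x => gstar x = c), ℓ (g x) w :=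
      Finset.sum_congr rfl fun x hx => by rw [hz x (Finset.mem_filter.1 hx).2]
    have hrest : ∑ x ∈ Finset.univ.filter (fun x => ¬ gstar x = c),
          ℓ (g x) (if gstar x = c then y else gstar x) =
        ∑ x ∈ Finset.univ.filter (fun x => ¬ gstar x = c), ℓ (g x) (gstar x) :=
      Finset.sum_congr rfl fun x hx => by rw [if_neg (Finset.mem_filter.1 hx).2]
    rw [hlevel gstar c fun _ hx => hx, hlevel _ y fun _ hx => if_pos hx, hrest] at h
    exact le_of_add_le_add_right h
  refine IsMinOn.of_isLocalMin_of_convex_univ hlocal ⟨convex_univ, fun a _ b _ s t hs ht hst => ?_⟩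
  simp only [Finset.smul_sum, ← Finset.sum_add_distrib]
  exact Finset.sum_le_sum fun x _ => (hconv (g x)).2 trivial trivial hs ht hst
end

section
/- Let (L, U) be a projection pair for g with separation constant c, witnessed by a minimizer g_L* of J_L(g, ·) over I_L and a minimizer g_U* of J_U(g, ·) over I_U with g_L*(x) ≤ c for all x ∈ L and c ≤ g_U*(x) for all x ∈ U. Then the function g_LU* : X → ℝ defined by g_LU*(x) = g_L*(x) for x ∈ L and g_LU*(x) = g_U*(x) for x ∈ U is isotonic on X and satisfies J_X(g, g_LU*) ≤ J_X(g, ĝ) for every ĝ ∈ I_X. -/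
open Pointwise Finset
open scoped Classical

variable {X : Type*}

/-- If `(L, U)` is a projection pair for `g` with separation constant `c`,
witnessed by minimizers `gL` and `gU`, then the glued function is isotonic on `X` and
minimizes `J_X(g, ·)` over `I_X`. -/
theorem projection_pair_glue_minimizes
    [Fintype X] [Nonempty X] [PartialOrder X] [DecidableEq X]
    (ℓ : ℝ → ℝ → ℝ) (hconv : ∀ a : ℝ, ConvexOn ℝ (Set.univ : Set ℝ) (ℓ a))
    (g : X → ℝ) (U L : Finset X)
    (hUupper : IsUpperFinset U) (hLcompl : L = Finset.univ \ U)
    (hUne : U.Nonempty) (hLne : L.Nonempty)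
    (c : ℝ) (gL gU : X → ℝ)
    (hgLiso : IsotonicOn gL L)
    (hgLmin : ∀ h : X → ℝ, IsotonicOn h L → lossJ ℓ g L gL ≤ lossJ ℓ g L h)
    (hgUiso : IsotonicOn gU U)
    (hgUmin : ∀ h : X → ℝ, IsotonicOn h U → lossJ ℓ g U gU ≤ lossJ ℓ g U h)
    (hLc : ∀ x ∈ L, gL x ≤ c) (hUc : ∀ x ∈ U, c ≤ gU x) :
    IsotonicOn (fun x => if x ∈ U then gU x else gL x) Finset.univ ∧
      ∀ h : X → ℝ, IsotonicOn h Finset.univ →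
        lossJ ℓ g Finset.univ (fun x => if x ∈ U then gU x else gL x) ≤
          lossJ ℓ g Finset.univ h := by
  have hmemL : ∀ x, x ∉ U → x ∈ L := fun x hx => by simp [hLcompl, hx]
  have hsplit : ∀ f : X → ℝ, lossJ ℓ g univ f = lossJ ℓ g L f + lossJ ℓ g U f := fun f => by
    rw [hLcompl]
    exact (sum_sdiff (subset_univ U)).symm
  refine ⟨fun x _ y _ hxy => ?_, fun h hh => ?_⟩
  · by_cases hx : x ∈ U
    · have hy := hUupper x hx y hxy
      simpa only [hx, hy, if_true] using hgUiso x hx y hy hxy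
    · by_cases hy : y ∈ U
      · simpa only [hx, hy, if_true, if_false] using (hLc x (hmemL x hx)).trans (hUc y hy)
      · simpa only [hx, hy, if_false] using hgLiso x (hmemL x hx) y (hmemL y hy) hxy
  · have hL : lossJ ℓ g L (fun x => if x ∈ U then gU x else gL x) = lossJ ℓ g L gL :=
      sum_congr rfl fun x hx => by
        have hxU : x ∉ U := by simpa [hLcompl] using hx
        simp only [hxU, if_false]
    have hU : lossJ ℓ g U (fun x => if x ∈ U then gU x else gL x) = lossJ ℓ g U gU :=
      sum_congr rfl fun x hx => by simp only [hx, if_true]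
    rw [hsplit, hsplit h, hL, hU]
    exact add_le_add (hgLmin h fun x _ y _ => hh x (mem_univ x) y (mem_univ y))
      (hgUmin h fun x _ y _ => hh x (mem_univ x) y (mem_univ y))
end

section
/- Let b ∈ ℝ and let (L, U) be a nontrivial complementary pair of X such that U is a maximal upper set with respect to b. Assume that J_L(g, ·) attains its minimum over I_L and that J_U(g, ·) attains its minimum over I_U. Then (L, U) is a projection pair for g with separation constant b. -/
open Pointwise Finset
open scoped Classical

variable {X : Type*}

/-- The right derivative of a convex function is its greatest subgradient. -/
lemma isGreatest_subdiff_rightDeriv {ℓ : ℝ → ℝ → ℝ} {a : ℝ}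
    (hconv : ConvexOn ℝ Set.univ (ℓ a)) (b : ℝ) :
    IsGreatest (subdiff ℓ a b) (derivWithin (ℓ a) (Set.Ioi b) b) := by
  have hb : b ∈ interior (Set.univ : Set ℝ) := by simp
  refine ⟨fun y => ?_, fun s hs => ?_⟩
  · rcases lt_trichotomy y b with h | rfl | h
    · have h1 := (hconv.slope_le_leftDeriv_of_mem_interior (Set.mem_univ y) hb h).trans
        (hconv.leftDeriv_le_rightDeriv_of_mem_interior hb)
      rw [slope_def_field, div_le_iff₀ (sub_pos.2 h)] at h1
      linarith
    · simp
    · have h1 := hconv.rightDeriv_le_slope_of_mem_interior hb (Set.mem_univ y) h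
      rw [slope_def_field, le_div_iff₀ (sub_pos.2 h)] at h1
      linarith
  · rw [hconv.rightDeriv_eq_sInf_slope_of_mem_interior hb]
    refine le_csInf ⟨_, Set.mem_image_of_mem _ ⟨Set.mem_univ (b + 1), lt_add_one b⟩⟩ ?_
    rintro _ ⟨y, ⟨-, hy⟩, rfl⟩
    rw [slope_def_field, le_div_iff₀ (sub_pos.2 hy)]
    linarith [hs y]

lemma sInf_SigmaSet {ℓ : ℝ → ℝ → ℝ} {g r : X → ℝ} {b : ℝ}
    (hr : ∀ x, IsGreatest (subdiff ℓ (g x) b) (r x)) (S : Finset X) :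
    sInf (SigmaSet ℓ g b S) = -∑ x ∈ S, r x := by
  refine IsLeast.csInf_eq ⟨?_, fun s hs => ?_⟩
  · rw [SigmaSet, Set.neg_mem_neg]
    exact Set.finsetSum_mem_finsetSum _ _ _ fun x _ => (hr x).1
  · obtain ⟨u, hu, hsum⟩ := (Set.mem_finsetSum _ _ _).1 (Set.mem_neg.1 hs)
    have := Finset.sum_le_sum fun x (hx : x ∈ S) => (hr x).2 (hu hx)
    linarith

/-- If the sums of `r` over all superlevel sets `{t < w}` with `t ≥ 0` are nonnegative, then so is
the sum of `r` weighted by the positive part of `w`. -/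
lemma sum_mul_max_nonneg_of_superlevel {r : X → ℝ} {S : Finset X} (w : X → ℝ)
    (h : ∀ t, 0 ≤ t → 0 ≤ ∑ x ∈ S with t < w x, r x) :
    0 ≤ ∑ x ∈ S, r x * max (w x) 0 := by
  induction hn : #{x ∈ S | 0 < w x} using Nat.strong_induction_on generalizing w with
  | _ n ih =>
    subst hn
    rcases {x ∈ S | 0 < w x}.eq_empty_or_nonempty with he | hne
    · refine (Finset.sum_eq_zero fun x hx => ?_).ge
      rw [max_eq_right (not_lt.1 (Finset.filter_eq_empty_iff.1 he hx)), mul_zero]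
    · obtain ⟨m, hm, hmin⟩ := Finset.exists_min_image _ w hne
      have hm' := Finset.mem_filter.1 hm
      have hlt : #{x ∈ S | 0 < w x - w m} < #{x ∈ S | 0 < w x} := by
        refine Finset.card_lt_card ⟨fun x hx => ?_, fun hsub => ?_⟩
        · rw [Finset.mem_filter] at hx ⊢
          exact ⟨hx.1, by linarith [hx.2, hm'.2]⟩
        · simpa using hsub hm
      have hrec := ih _ hlt (fun x => w x - w m) (fun t ht => by
        simpa only [lt_sub_iff_add_lt] using h (t + w m) (add_nonneg ht hm'.2.le)) rfl
      have hsplit : ∑ x ∈ S, r x * max (w x) 0 =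
          w m * (∑ x ∈ S with 0 < w x, r x) + ∑ x ∈ S, r x * max (w x - w m) 0 := by
        rw [Finset.mul_sum, Finset.sum_filter, ← Finset.sum_add_distrib]
        refine Finset.sum_congr rfl fun x hx => ?_
        split_ifs with hx0
        · have := hmin x (Finset.mem_filter.2 ⟨hx, hx0⟩)
          rw [max_eq_left hx0.le, max_eq_left (sub_nonneg.2 this)]
          ring
        · rw [max_eq_right (not_lt.1 hx0), max_eq_right (by linarith [hm'.2])]
          ring
      rw [hsplit]
      exact add_nonneg (mul_nonneg hm'.2.le (h 0 le_rfl)) hrec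

lemma lossJ_min_le {ℓ : ℝ → ℝ → ℝ} {g r : X → ℝ} {b : ℝ}
    (hr : ∀ x, r x ∈ subdiff ℓ (g x) b) {S : Finset X} {f : X → ℝ}
    (h : ∀ t, 0 ≤ t → 0 ≤ ∑ x ∈ S with t < f x - b, r x) :
    lossJ ℓ g S (fun x => min (f x) b) ≤ lossJ ℓ g S f := by
  have hsum : ∑ x ∈ S, (ℓ (g x) (min (f x) b) + r x * max (f x - b) 0) ≤ lossJ ℓ g S f := by
    refine Finset.sum_le_sum fun x _ => ?_
    rcases le_total (f x) b with hx | hx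
    · simp [hx]
    · rw [min_eq_right hx, max_eq_left (sub_nonneg.2 hx)]
      exact hr x (f x)
  rw [Finset.sum_add_distrib] at hsum
  unfold lossJ at *
  linarith [sum_mul_max_nonneg_of_superlevel _ h]

lemma lossJ_max_le {ℓ : ℝ → ℝ → ℝ} {g r : X → ℝ} {b : ℝ}
    (hr : ∀ x, r x ∈ subdiff ℓ (g x) b) {S : Finset X} {f : X → ℝ}
    (h : ∀ t, 0 ≤ t → ∑ x ∈ S with t < b - f x, r x ≤ 0) :
    lossJ ℓ g S (fun x => max (f x) b) ≤ lossJ ℓ g S f := by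
  have hsum : ∑ x ∈ S, (ℓ (g x) (max (f x) b) + -r x * max (b - f x) 0) ≤ lossJ ℓ g S f := by
    refine Finset.sum_le_sum fun x _ => ?_
    rcases le_total b (f x) with hx | hx
    · simp [hx]
    · rw [max_eq_right hx, max_eq_left (sub_nonneg.2 hx)]
      linarith [hr x (f x)]
  have hneg : 0 ≤ ∑ x ∈ S, -r x * max (b - f x) 0 :=
    sum_mul_max_nonneg_of_superlevel (r := fun x => -r x) _ fun t ht => by
      rw [Finset.sum_neg_distrib]
      exact neg_nonneg.2 (h t ht)
  rw [Finset.sum_add_distrib] at hsum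
  unfold lossJ at *
  linarith

/-- If `(L, U)` is a nontrivial complementary pair with `U` a maximal
upper set w.r.t. `b`, and the restricted problems attain their minima, then `(L, U)`
is a projection pair for `g` with separation constant `b`. -/
theorem maximal_upper_set_gives_projection_pair
    [Fintype X] [Nonempty X] [PartialOrder X]
    (ℓ : ℝ → ℝ → ℝ) (hconv : ∀ a : ℝ, ConvexOn ℝ (Set.univ : Set ℝ) (ℓ a))
    (g : X → ℝ) (b : ℝ) (U L : Finset X)
    (hLcompl : L = Finset.univ \ U)
    (hUne : U.Nonempty) (hLne : L.Nonempty)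
    (hmax : IsMaxUpper ℓ g b U)
    (hattL : ∃ f : X → ℝ, IsotonicOn f L ∧
      ∀ h : X → ℝ, IsotonicOn h L → lossJ ℓ g L f ≤ lossJ ℓ g L h)
    (hattU : ∃ f : X → ℝ, IsotonicOn f U ∧
      ∀ h : X → ℝ, IsotonicOn h U → lossJ ℓ g U f ≤ lossJ ℓ g U h) :
    ∃ gL gU : X → ℝ,
      (IsotonicOn gL L ∧
        ∀ h : X → ℝ, IsotonicOn h L → lossJ ℓ g L gL ≤ lossJ ℓ g L h) ∧
      (IsotonicOn gU U ∧
        ∀ h : X → ℝ, IsotonicOn h U → lossJ ℓ g U gU ≤ lossJ ℓ g U h) ∧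
      (∀ x ∈ L, gL x ≤ b) ∧ (∀ x ∈ U, b ≤ gU x) := by
  obtain ⟨fL, hfL, hminL⟩ := hattL
  obtain ⟨fU, hfU, hminU⟩ := hattU
  obtain ⟨r, hr⟩ : ∃ r : X → ℝ, ∀ x, IsGreatest (subdiff ℓ (g x) b) (r x) :=
    ⟨_, fun x => isGreatest_subdiff_rightDeriv (hconv (g x)) b⟩
  obtain ⟨hU, hopt⟩ := hmax
  have hsum_le : ∀ V : Finset X, IsUpperFinset V → ∑ x ∈ U, r x ≤ ∑ x ∈ V, r x := by
    intro V hV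
    have := hopt V hV
    rw [sInf_SigmaSet hr, sInf_SigmaSet hr] at this
    exact neg_le_neg_iff.1 this
  have hmemL : ∀ x, x ∈ L ↔ x ∉ U := by simp [hLcompl]
  have hlower : ∀ t, 0 ≤ t → 0 ≤ ∑ x ∈ L with t < fL x - b, r x := by
    intro t _
    have hup : IsUpperFinset (U ∪ {x ∈ L | t < fL x - b}) := by
      intro x hx y hxy
      rw [Finset.mem_union, Finset.mem_filter] at hx ⊢
      by_cases hy : y ∈ U
      · exact Or.inl hy
      · have hxU : x ∉ U := fun hxU => hy (hU x hxU y hxy)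
        obtain ⟨hxL, hxt⟩ := hx.resolve_left hxU
        have hyL := (hmemL y).2 hy
        exact Or.inr ⟨hyL, by linarith [hfL x hxL y hyL hxy]⟩
    have hdisj : Disjoint U {x ∈ L | t < fL x - b} :=
      Finset.disjoint_left.2 fun x hxU hx => (hmemL x).1 (Finset.mem_filter.1 hx).1 hxU
    have := hsum_le _ hup
    rw [Finset.sum_union hdisj] at this
    linarith
  have hupper : ∀ t, 0 ≤ t → ∑ x ∈ U with t < b - fU x, r x ≤ 0 := by
    intro t _
    have hup : IsUpperFinset {x ∈ U | ¬ t < b - fU x} := by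
      intro x hx y hxy
      rw [Finset.mem_filter] at hx ⊢
      have hyU := hU x hx.1 y hxy
      exact ⟨hyU, fun hy => hx.2 (by linarith [hfU x hx.1 y hyU hxy])⟩
    have := hsum_le _ hup
    rw [← Finset.sum_filter_add_sum_filter_not U (fun x => t < b - fU x)] at this
    linarith
  refine ⟨fun x => min (fL x) b, fun x => max (fU x) b, ⟨?_, fun h hh => ?_⟩, ⟨?_, fun h hh => ?_⟩,
    fun x _ => min_le_right _ _, fun x _ => le_max_right _ _⟩
  · exact fun x hx y hy hxy => min_le_min_right b (hfL x hx y hy hxy)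
  · exact (lossJ_min_le (fun x => (hr x).1) hlower).trans (hminL h hh)
  · exact fun x hx y hy hxy => max_le_max_right b (hfU x hx y hy hxy)
  · exact (lossJ_max_le (fun x => (hr x).1) hupper).trans (hminU h hh)
end

section
/- Suppose b ∈ Cf_g(X), i.e., b minimizes y ↦ Σ_{x∈X} ℓ(g(x), y) over ℝ. If the empty set is both a maximal upper set and a minimal lower set of X with respect to b, then the constant function x ↦ b is isotonic and minimizes J_X(g, ·) over I_X. -/
open Pointwise Finset
open scoped Classical

variable {X : Type*}

/-- A nonnegative weight `φ` integrates `r` nonnegatively as soon as `r` has nonnegative sum over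
every strict superlevel set of `φ` (layer-cake decomposition). -/
theorem sum_mul_nonneg_of_superlevel {ι : Type*} [Fintype ι] (r φ : ι → ℝ) (hφ : ∀ x, 0 ≤ φ x)
    (hr : ∀ t : ℝ, 0 ≤ t → 0 ≤ ∑ x with t < φ x, r x) : 0 ≤ ∑ x, r x * φ x := by
  induction hn : (univ.filter fun x => 0 < φ x).card using Nat.strong_induction_on
    generalizing φ with
  | _ n ih =>
    set U : Finset ι := univ.filter fun x => 0 < φ x with hU
    have hmemU : ∀ x, x ∈ U ↔ 0 < φ x := by simp [hU]
    rcases U.eq_empty_or_nonempty with hempty | hne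
    · have hzero : ∀ x, φ x = 0 := fun x =>
        le_antisymm (not_lt.1 fun hx => by simpa [hempty] using (hmemU x).2 hx) (hφ x)
      simp [hzero]
    · obtain ⟨z, hzU, hz⟩ := U.exists_min_image φ hne
      have hzpos := (hmemU z).1 hzU
      set ψ : ι → ℝ := fun x => if x ∈ U then φ x - φ z else 0 with hψ
      have hψ_nonneg : ∀ x, 0 ≤ ψ x := by
        intro x
        by_cases hx : x ∈ U
        · simpa [hψ, hx] using hz x hx
        · simp [hψ, hx]
      have hlevel : ∀ t : ℝ, 0 ≤ t → ∀ x, t < ψ x ↔ t + φ z < φ x := by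
        intro t ht x
        by_cases hx : x ∈ U
        · simp [hψ, hx, lt_sub_iff_add_lt]
        · have hx0 := not_lt.1 (mt (hmemU x).2 hx)
          simp only [hψ, hx, if_false]
          constructor <;> intro h <;> linarith
      have hψ_sum : 0 ≤ ∑ x, r x * ψ x := by
        refine ih _ ?_ ψ hψ_nonneg (fun t ht => ?_) rfl
        · rw [← hn]
          refine card_lt_card ((ssubset_iff_of_subset fun x hx => ?_).2 ⟨z, hzU, ?_⟩)
          · have := (hlevel 0 le_rfl x).1 (by simpa using hx)
            exact (hmemU x).2 (by linarith)
          · simp [hψ, hzU]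
        · simp only [hlevel t ht]
          exact hr _ (by linarith)
      have hsplit : ∑ x, r x * φ x = ∑ x, r x * ψ x + φ z * ∑ x ∈ U, r x := by
        rw [mul_sum, ← sum_filter_add_sum_filter_not univ (· ∈ U) (fun x => r x * φ x),
          ← sum_filter_add_sum_filter_not univ (· ∈ U) (fun x => r x * ψ x)]
        have hout : ∀ x ∈ univ.filter (· ∉ U), r x * φ x = 0 := by
          intro x hx
          have hx0 := not_lt.1 (mt (hmemU x).2 (by simpa using hx))
          simp [le_antisymm hx0 (hφ x)]
        have hout' : ∀ x ∈ univ.filter (· ∉ U), r x * ψ x = 0 := by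
          intro x hx
          have : x ∉ U := by simpa using hx
          simp [hψ, this]
        rw [sum_eq_zero hout, sum_eq_zero hout', filter_mem_eq_inter, univ_inter, add_zero,
          add_zero, ← sum_add_distrib]
        refine sum_congr rfl fun x hx => ?_
        simp only [hψ, hx, if_true]
        ring
      rw [hsplit]
      exact add_nonneg hψ_sum (mul_nonneg hzpos.le (hr 0 le_rfl))

theorem subdiff_nonempty {ℓ : ℝ → ℝ → ℝ} {a : ℝ} (hconv : ConvexOn ℝ Set.univ (ℓ a)) (b : ℝ) :
    (subdiff ℓ a b).Nonempty := by
  have hint : b ∈ interior (Set.univ : Set ℝ) := by simp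
  refine ⟨derivWithin (ℓ a) (Set.Ioi b) b, fun y => ?_⟩
  rcases lt_trichotomy y b with hy | rfl | hy
  · have h := (hconv.slope_le_leftDeriv_of_mem_interior (Set.mem_univ y) hint hy).trans
      (hconv.leftDeriv_le_rightDeriv_of_mem_interior hint)
    rw [slope_def_field, div_le_iff₀ (sub_pos.2 hy)] at h
    linarith
  · simp
  · have h := hconv.rightDeriv_le_slope_of_mem_interior hint (Set.mem_univ y) hy
    rw [slope_def_field, le_div_iff₀ (sub_pos.2 hy)] at h
    linarith

theorem bddAbove_subdiff (ℓ : ℝ → ℝ → ℝ) (a b : ℝ) : BddAbove (subdiff ℓ a b) :=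
  ⟨ℓ a (b + 1) - ℓ a b, fun s hs => by linarith [hs (b + 1)]⟩

theorem bddBelow_subdiff (ℓ : ℝ → ℝ → ℝ) (a b : ℝ) : BddBelow (subdiff ℓ a b) :=
  ⟨ℓ a b - ℓ a (b - 1), fun s hs => by linarith [hs (b - 1)]⟩

theorem add_sSup_subdiff_mul_le {ℓ : ℝ → ℝ → ℝ} {a b y : ℝ} (hne : (subdiff ℓ a b).Nonempty)
    (hy : b ≤ y) : ℓ a b + sSup (subdiff ℓ a b) * (y - b) ≤ ℓ a y := by
  rcases hy.eq_or_lt with rfl | hy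
  · simp
  · have h : sSup (subdiff ℓ a b) ≤ (ℓ a y - ℓ a b) / (y - b) := csSup_le hne fun s hs => by
      rw [le_div_iff₀ (sub_pos.2 hy)]
      linarith [hs y]
    rw [le_div_iff₀ (sub_pos.2 hy)] at h
    linarith

theorem add_sInf_subdiff_mul_le {ℓ : ℝ → ℝ → ℝ} {a b y : ℝ} (hne : (subdiff ℓ a b).Nonempty)
    (hy : y ≤ b) : ℓ a b + sInf (subdiff ℓ a b) * (y - b) ≤ ℓ a y := by
  rcases hy.eq_or_lt with rfl | hy
  · simp
  · have h : (ℓ a b - ℓ a y) / (b - y) ≤ sInf (subdiff ℓ a b) := le_csInf hne fun s hs => by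
      rw [div_le_iff₀ (sub_pos.2 hy)]
      linarith [hs y]
    rw [div_le_iff₀ (sub_pos.2 hy)] at h
    linarith

theorem mem_SigmaSet {ℓ : ℝ → ℝ → ℝ} {g : X → ℝ} {b s : ℝ} {S : Finset X} :
    s ∈ SigmaSet ℓ g b S ↔
      ∃ (c : X → ℝ) (_ : ∀ {x}, x ∈ S → c x ∈ subdiff ℓ (g x) b), ∑ x ∈ S, c x = -s := by
  rw [SigmaSet, Set.mem_neg, Set.mem_finsetSum]

theorem SigmaSet_nonempty {ℓ : ℝ → ℝ → ℝ} {g : X → ℝ} {b : ℝ} {S : Finset X}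
    (hne : ∀ x, (subdiff ℓ (g x) b).Nonempty) : (SigmaSet ℓ g b S).Nonempty := by
  choose c hc using hne
  exact ⟨-∑ x ∈ S, c x, mem_SigmaSet.2 ⟨c, fun _ => hc _, by simp⟩⟩

theorem neg_sum_sSup_le_sInf_SigmaSet {ℓ : ℝ → ℝ → ℝ} {g : X → ℝ} {b : ℝ} (S : Finset X)
    (hne : ∀ x, (subdiff ℓ (g x) b).Nonempty) :
    -∑ x ∈ S, sSup (subdiff ℓ (g x) b) ≤ sInf (SigmaSet ℓ g b S) := by
  refine le_csInf (SigmaSet_nonempty hne) fun s hs => ?_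
  obtain ⟨c, hc, hcs⟩ := mem_SigmaSet.1 hs
  have := sum_le_sum fun x (hx : x ∈ S) => le_csSup (bddAbove_subdiff ℓ (g x) b) (hc hx)
  linarith

theorem sSup_SigmaSet_le_neg_sum_sInf {ℓ : ℝ → ℝ → ℝ} {g : X → ℝ} {b : ℝ} (S : Finset X)
    (hne : ∀ x, (subdiff ℓ (g x) b).Nonempty) :
    sSup (SigmaSet ℓ g b S) ≤ -∑ x ∈ S, sInf (subdiff ℓ (g x) b) := by
  refine csSup_le (SigmaSet_nonempty hne) fun s hs => ?_
  obtain ⟨c, hc, hcs⟩ := mem_SigmaSet.1 hs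
  have := sum_le_sum fun x (hx : x ∈ S) => csInf_le (bddBelow_subdiff ℓ (g x) b) (hc hx)
  linarith

theorem SigmaSet_empty (ℓ : ℝ → ℝ → ℝ) (g : X → ℝ) (b : ℝ) :
    SigmaSet ℓ g b (∅ : Finset X) = {0} := by
  ext s
  simp [SigmaSet]

/-- If `b ∈ Cf_g(X)` and the empty set is both a maximal upper set and a
minimal lower set w.r.t. `b`, then the constant function `b` is isotonic and minimizes
`J_X(g, ·)` over `I_X`. -/
theorem constant_fit_terminal_case
    [Fintype X] [Nonempty X] [PartialOrder X]
    (ℓ : ℝ → ℝ → ℝ) (hconv : ∀ a : ℝ, ConvexOn ℝ (Set.univ : Set ℝ) (ℓ a))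
    (g : X → ℝ) (b : ℝ)
    (hb : ∀ y : ℝ, ∑ x : X, ℓ (g x) b ≤ ∑ x : X, ℓ (g x) y)
    (hmax : IsMaxUpper ℓ g b (∅ : Finset X))
    (hmin : IsMinLower ℓ g b (∅ : Finset X)) :
    IsotonicOn (fun _ : X => b) Finset.univ ∧
      ∀ h : X → ℝ, IsotonicOn h Finset.univ →
        lossJ ℓ g Finset.univ (fun _ : X => b) ≤ lossJ ℓ g Finset.univ h := by
  refine ⟨fun _ _ _ _ _ => le_rfl, fun h hh => ?_⟩
  have hne : ∀ x, (subdiff ℓ (g x) b).Nonempty := fun x => subdiff_nonempty (hconv (g x)) b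
  have hup : 0 ≤ ∑ x, sSup (subdiff ℓ (g x) b) * max (h x - b) 0 := by
    refine sum_mul_nonneg_of_superlevel _ _ (fun x => le_max_right _ _) fun t ht => ?_
    have hle := hmax.2 (univ.filter fun x => t < max (h x - b) 0) fun x hx y hxy => by
      have hmono := hh x (mem_univ x) y (mem_univ y) hxy
      simp only [mem_filter, mem_univ, true_and] at hx ⊢
      exact hx.trans_le (max_le_max_right 0 (by linarith))
    rw [SigmaSet_empty, csInf_singleton] at hle
    linarith [neg_sum_sSup_le_sInf_SigmaSet (univ.filter fun x => t < max (h x - b) 0) hne]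
  have hlow : 0 ≤ ∑ x, -sInf (subdiff ℓ (g x) b) * max (b - h x) 0 := by
    refine sum_mul_nonneg_of_superlevel _ _ (fun x => le_max_right _ _) fun t ht => ?_
    have hle := hmin.2 (univ.filter fun x => t < max (b - h x) 0) fun y hy x hxy => by
      have hmono := hh x (mem_univ x) y (mem_univ y) hxy
      simp only [mem_filter, mem_univ, true_and] at hy ⊢
      exact hy.trans_le (max_le_max_right 0 (by linarith))
    rw [SigmaSet_empty, csSup_singleton] at hle
    rw [sum_neg_distrib]
    exact hle.trans (sSup_SigmaSet_le_neg_sum_sInf _ hne)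
  have hpoint : ∀ x, ℓ (g x) b + (sSup (subdiff ℓ (g x) b) * max (h x - b) 0 +
      -sInf (subdiff ℓ (g x) b) * max (b - h x) 0) ≤ ℓ (g x) (h x) := by
    intro x
    rcases le_total b (h x) with hx | hx
    · rw [max_eq_left (sub_nonneg.2 hx), max_eq_right (sub_nonpos.2 hx)]
      linarith [add_sSup_subdiff_mul_le (hne x) hx]
    · rw [max_eq_right (sub_nonpos.2 hx), max_eq_left (sub_nonneg.2 hx)]
      linarith [add_sInf_subdiff_mul_le (hne x) hx]
  have hsum := sum_le_sum fun x (_ : x ∈ univ) => hpoint x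
  rw [sum_add_distrib, sum_add_distrib] at hsum
  unfold lossJ
  linarith
end

section
/- Suppose b ∈ Cf_g(X), i.e., b minimizes y ↦ Σ_{x∈X} ℓ(g(x), y) over ℝ. If X is a maximal upper set with respect to b, then min Σ_b(X) = 0 and the empty set is also a maximal upper set with respect to b. Dually, if X is a minimal lower set with respect to b, then max Σ_b(X) = 0 and the empty set is also a minimal lower set with respect to b. -/
open Pointwise Finset
open scoped Classical

variable {X : Type*}

theorem rightDeriv_mem_subdiff {ℓ : ℝ → ℝ → ℝ} {a : ℝ}
    (hconv : ConvexOn ℝ (Set.univ : Set ℝ) (ℓ a)) (b : ℝ) :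
    derivWithin (ℓ a) (Set.Ioi b) b ∈ subdiff ℓ a b := by
  have hint : ∀ z : ℝ, z ∈ interior (Set.univ : Set ℝ) := by simp
  intro y
  rcases lt_trichotomy b y with h | rfl | h
  · have h1 := hconv.rightDeriv_le_slope_of_mem_interior (hint b) (Set.mem_univ y) h
    rw [slope_def_field, le_div_iff₀ (sub_pos.2 h)] at h1
    linarith
  · simp
  · have h1 := (hconv.slope_le_leftDeriv_of_mem_interior (Set.mem_univ y) (hint b) h).trans
      (hconv.leftDeriv_le_rightDeriv_of_mem_interior (hint b))
    rw [slope_def_field, div_le_iff₀ (sub_pos.2 h)] at h1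
    linarith

theorem leftDeriv_mem_subdiff {ℓ : ℝ → ℝ → ℝ} {a : ℝ}
    (hconv : ConvexOn ℝ (Set.univ : Set ℝ) (ℓ a)) (b : ℝ) :
    derivWithin (ℓ a) (Set.Iio b) b ∈ subdiff ℓ a b := by
  have hint : ∀ z : ℝ, z ∈ interior (Set.univ : Set ℝ) := by simp
  intro y
  rcases lt_trichotomy b y with h | rfl | h
  · have h1 := (hconv.leftDeriv_le_rightDeriv_of_mem_interior (hint b)).trans
      (hconv.rightDeriv_le_slope_of_mem_interior (hint b) (Set.mem_univ y) h)
    rw [slope_def_field, le_div_iff₀ (sub_pos.2 h)] at h1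
    linarith
  · simp
  · have h1 := hconv.slope_le_leftDeriv_of_mem_interior (Set.mem_univ y) (hint b) h
    rw [slope_def_field, div_le_iff₀ (sub_pos.2 h)] at h1
    linarith

theorem neg_sum_mem_SigmaSet {ℓ : ℝ → ℝ → ℝ} {g : X → ℝ} {b : ℝ} {S : Finset X} {s : X → ℝ}
    (hs : ∀ x ∈ S, s x ∈ subdiff ℓ (g x) b) : -∑ x ∈ S, s x ∈ SigmaSet ℓ g b S := by
  rw [SigmaSet, Set.neg_mem_neg]
  exact Set.finsetSum_mem_finsetSum _ _ _ hs

theorem exists_eq_neg_sum_of_mem_SigmaSet {ℓ : ℝ → ℝ → ℝ} {g : X → ℝ} {b : ℝ} {S : Finset X}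
    {t : ℝ} (ht : t ∈ SigmaSet ℓ g b S) :
    ∃ s : X → ℝ, (∀ x ∈ S, s x ∈ subdiff ℓ (g x) b) ∧ t = -∑ x ∈ S, s x := by
  rw [SigmaSet, Set.mem_neg, Set.mem_finsetSum] at ht
  obtain ⟨s, hs, hst⟩ := ht
  exact ⟨s, fun x hx => hs hx, by rw [hst, neg_neg]⟩

theorem bddBelow_SigmaSet (ℓ : ℝ → ℝ → ℝ) (g : X → ℝ) (b : ℝ) (S : Finset X) :
    BddBelow (SigmaSet ℓ g b S) := by
  refine ⟨-∑ x ∈ S, (ℓ (g x) (b + 1) - ℓ (g x) b), fun t ht => ?_⟩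
  obtain ⟨s, hs, rfl⟩ := exists_eq_neg_sum_of_mem_SigmaSet ht
  refine neg_le_neg (Finset.sum_le_sum fun x hx => ?_)
  have := hs x hx (b + 1)
  linarith

theorem bddAbove_SigmaSet (ℓ : ℝ → ℝ → ℝ) (g : X → ℝ) (b : ℝ) (S : Finset X) :
    BddAbove (SigmaSet ℓ g b S) := by
  refine ⟨-∑ x ∈ S, (ℓ (g x) b - ℓ (g x) (b - 1)), fun t ht => ?_⟩
  obtain ⟨s, hs, rfl⟩ := exists_eq_neg_sum_of_mem_SigmaSet ht
  refine neg_le_neg (Finset.sum_le_sum fun x hx => ?_)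
  have := hs x hx (b - 1)
  linarith

/-- At a minimizer of the total loss, the sum of the right derivatives is nonnegative. -/
theorem sum_rightDeriv_nonneg {ℓ : ℝ → ℝ → ℝ}
    (hconv : ∀ a : ℝ, ConvexOn ℝ (Set.univ : Set ℝ) (ℓ a)) {g : X → ℝ} {b : ℝ} {S : Finset X}
    (hb : ∀ y : ℝ, ∑ x ∈ S, ℓ (g x) b ≤ ∑ x ∈ S, ℓ (g x) y) :
    0 ≤ ∑ x ∈ S, derivWithin (ℓ (g x)) (Set.Ioi b) b := by
  have hd : HasDerivWithinAt (fun y => ∑ x ∈ S, ℓ (g x) y)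
      (∑ x ∈ S, derivWithin (ℓ (g x)) (Set.Ioi b) b) (Set.Ioi b) b :=
    HasDerivWithinAt.fun_sum fun x _ =>
      (hconv (g x)).hasDerivWithinAt_rightDeriv_of_mem_interior (by simp)
  refine ge_of_tendsto ((hasDerivWithinAt_iff_tendsto_slope' Set.self_notMem_Ioi).mp hd) ?_
  filter_upwards [self_mem_nhdsWithin] with y hy
  rw [slope_def_field]
  exact div_nonneg (sub_nonneg.2 (hb y)) (sub_nonneg.2 (le_of_lt hy))

/-- At a minimizer of the total loss, the sum of the left derivatives is nonpositive. -/
theorem sum_leftDeriv_nonpos {ℓ : ℝ → ℝ → ℝ}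
    (hconv : ∀ a : ℝ, ConvexOn ℝ (Set.univ : Set ℝ) (ℓ a)) {g : X → ℝ} {b : ℝ} {S : Finset X}
    (hb : ∀ y : ℝ, ∑ x ∈ S, ℓ (g x) b ≤ ∑ x ∈ S, ℓ (g x) y) :
    ∑ x ∈ S, derivWithin (ℓ (g x)) (Set.Iio b) b ≤ 0 := by
  have hd : HasDerivWithinAt (fun y => ∑ x ∈ S, ℓ (g x) y)
      (∑ x ∈ S, derivWithin (ℓ (g x)) (Set.Iio b) b) (Set.Iio b) b :=
    HasDerivWithinAt.fun_sum fun x _ =>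
      (hconv (g x)).hasDerivWithinAt_leftDeriv_of_mem_interior (by simp)
  refine le_of_tendsto ((hasDerivWithinAt_iff_tendsto_slope' Set.self_notMem_Iio).mp hd) ?_
  filter_upwards [self_mem_nhdsWithin] with y hy
  rw [slope_def_field]
  exact div_nonpos_of_nonneg_of_nonpos (sub_nonneg.2 (hb y)) (sub_nonpos.2 (le_of_lt hy))

theorem sInf_SigmaSet_nonpos {ℓ : ℝ → ℝ → ℝ}
    (hconv : ∀ a : ℝ, ConvexOn ℝ (Set.univ : Set ℝ) (ℓ a)) {g : X → ℝ} {b : ℝ} {S : Finset X}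
    (hb : ∀ y : ℝ, ∑ x ∈ S, ℓ (g x) b ≤ ∑ x ∈ S, ℓ (g x) y) :
    sInf (SigmaSet ℓ g b S) ≤ 0 :=
  (csInf_le (bddBelow_SigmaSet ℓ g b S)
    (neg_sum_mem_SigmaSet fun x _ => rightDeriv_mem_subdiff (hconv (g x)) b)).trans
    (neg_nonpos.2 (sum_rightDeriv_nonneg hconv hb))

theorem sSup_SigmaSet_nonneg {ℓ : ℝ → ℝ → ℝ}
    (hconv : ∀ a : ℝ, ConvexOn ℝ (Set.univ : Set ℝ) (ℓ a)) {g : X → ℝ} {b : ℝ} {S : Finset X}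
    (hb : ∀ y : ℝ, ∑ x ∈ S, ℓ (g x) b ≤ ∑ x ∈ S, ℓ (g x) y) :
    0 ≤ sSup (SigmaSet ℓ g b S) :=
  (neg_nonneg.2 (sum_leftDeriv_nonpos hconv hb)).trans
    (le_csSup (bddAbove_SigmaSet ℓ g b S)
      (neg_sum_mem_SigmaSet fun x _ => leftDeriv_mem_subdiff (hconv (g x)) b))

/-- Let `b ∈ Cf_g(X)`. If `X` is a maximal upper set w.r.t. `b`, then
`min Σ_b(X) = 0` and `∅` is also a maximal upper set; dually, if `X` is a minimal
lower set w.r.t. `b`, then `max Σ_b(X) = 0` and `∅` is also a minimal lower set. -/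
theorem whole_set_maximal_implies_empty_maximal
    [Fintype X] [Nonempty X] [PartialOrder X]
    (ℓ : ℝ → ℝ → ℝ) (hconv : ∀ a : ℝ, ConvexOn ℝ (Set.univ : Set ℝ) (ℓ a))
    (g : X → ℝ) (b : ℝ)
    (hb : ∀ y : ℝ, ∑ x : X, ℓ (g x) b ≤ ∑ x : X, ℓ (g x) y) :
    (IsMaxUpper ℓ g b (Finset.univ : Finset X) →
      sInf (SigmaSet ℓ g b (Finset.univ : Finset X)) = 0 ∧
        IsMaxUpper ℓ g b (∅ : Finset X)) ∧
    (IsMinLower ℓ g b (Finset.univ : Finset X) →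
      sSup (SigmaSet ℓ g b (Finset.univ : Finset X)) = 0 ∧
        IsMinLower ℓ g b (∅ : Finset X)) := by
  have hempty_upper : IsUpperFinset (∅ : Finset X) := fun x hx => by simp at hx
  have hempty_lower : IsLowerFinset (∅ : Finset X) := fun x hx => by simp at hx
  have hinf : sInf (SigmaSet ℓ g b (∅ : Finset X)) = 0 := by simp [SigmaSet_empty]
  have hsup : sSup (SigmaSet ℓ g b (∅ : Finset X)) = 0 := by simp [SigmaSet_empty]
  constructor
  · rintro ⟨-, hmax⟩
    have h0 : sInf (SigmaSet ℓ g b (Finset.univ : Finset X)) = 0 :=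
      le_antisymm (sInf_SigmaSet_nonpos hconv hb) (hinf ▸ hmax ∅ hempty_upper)
    exact ⟨h0, hempty_upper, fun U hU => (hmax U hU).trans_eq (h0.trans hinf.symm)⟩
  · rintro ⟨-, hmin⟩
    have h0 : sSup (SigmaSet ℓ g b (Finset.univ : Finset X)) = 0 :=
      le_antisymm (hsup ▸ hmin ∅ hempty_lower) (sSup_SigmaSet_nonneg hconv hb)
    exact ⟨h0, hempty_lower, fun L hL => (hsup.trans h0.symm).trans_le (hmin L hL)⟩
end

section
/- Let b ∈ ℝ, let U be a nonempty maximal upper set of X with respect to b, and suppose g• minimizes J_U(g, ·) over I_U. Then the function x ↦ max(b, g•(x)) also minimizes J_U(g, ·) over I_U. -/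
open Pointwise Finset
open scoped Classical

variable {X : Type*}

theorem exists_isGreatest_subdiff (ℓ : ℝ → ℝ → ℝ) (a b : ℝ)
    (h : ConvexOn ℝ (Set.univ : Set ℝ) (ℓ a)) : ∃ d, IsGreatest (subdiff ℓ a b) d := by
  set T : Set ℝ := (fun y => (ℓ a y - ℓ a b) / (y - b)) '' Set.Ioi b with hT
  have key : ∀ x < b, ∀ t ∈ T, (ℓ a b - ℓ a x) / (b - x) ≤ t := by
    rintro x hx _ ⟨y, hy, rfl⟩
    exact h.slope_mono_adjacent (Set.mem_univ x) (Set.mem_univ y) hx hy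
  have hne : T.Nonempty := ⟨_, b + 1, by simp, rfl⟩
  have hbdd : BddBelow T := ⟨_, fun t ht => key (b - 1) (by linarith) t ht⟩
  refine ⟨sInf T, fun y => ?_, fun s hs => le_csInf hne ?_⟩
  · rcases lt_trichotomy y b with hy | rfl | hy
    · have h1 := le_csInf hne (key y hy)
      rw [div_le_iff₀ (by linarith)] at h1
      linarith
    · simp
    · have h1 : sInf T ≤ (ℓ a y - ℓ a b) / (y - b) := csInf_le hbdd ⟨y, hy, rfl⟩
      rw [le_div_iff₀ (by linarith)] at h1
      linarith
  · rintro _ ⟨y, hy, rfl⟩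
    have hy' : b < y := hy
    have h1 := hs y
    change s ≤ (ℓ a y - ℓ a b) / (y - b)
    rw [le_div_iff₀ (by linarith)]
    linarith

theorem sInf_SigmaSet_eq (ℓ : ℝ → ℝ → ℝ) (g : X → ℝ) (b : ℝ) (d : X → ℝ)
    (hd : ∀ x, IsGreatest (subdiff ℓ (g x) b) (d x)) (S : Finset X) :
    sInf (SigmaSet ℓ g b S) = -∑ x ∈ S, d x := by
  refine IsLeast.csInf_eq ⟨?_, fun s hs => ?_⟩
  · rw [SigmaSet, Set.neg_mem_neg, Set.mem_finsetSum]
    exact ⟨d, fun {i} _ => (hd i).1, rfl⟩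
  · rw [SigmaSet, Set.mem_neg, Set.mem_finsetSum] at hs
    obtain ⟨e, he, hes⟩ := hs
    have : ∑ x ∈ S, e x ≤ ∑ x ∈ S, d x := sum_le_sum fun x hx => (hd x).2 (he hx)
    linarith

/-- A layer-cake inequality: if `d` has nonpositive sum over every superlevel set of a
nonnegative weight `w`, then the weighted sum of `d` is nonpositive. -/
theorem sum_mul_nonpos_of_superlevel (U : Finset X) (d w : X → ℝ) (hw : ∀ x ∈ U, 0 ≤ w x)
    (h : ∀ t, 0 ≤ t → ∑ x ∈ U with t < w x, d x ≤ 0) : ∑ x ∈ U, d x * w x ≤ 0 := by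
  induction hn : #{x ∈ U | 0 < w x} using Nat.strong_induction_on generalizing w with
  | _ n ih =>
    rcases ({x ∈ U | 0 < w x}).eq_empty_or_nonempty with hA | hA
    · refine (sum_eq_zero fun x hx => ?_).le
      have h0 : ¬ 0 < w x := filter_eq_empty_iff.1 hA hx
      rw [le_antisymm (not_lt.1 h0) (hw x hx), mul_zero]
    · obtain ⟨x₀, hx₀, hle⟩ := exists_min_image _ w hA
      rw [mem_filter] at hx₀
      have hlevel : ∀ t, 0 ≤ t →
          {x ∈ U | t < max (w x - w x₀) 0} = {x ∈ U | t + w x₀ < w x} := fun t ht =>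
        filter_congr fun x _ => by
          rw [lt_max_iff, or_iff_left ht.not_gt, lt_sub_iff_add_lt]
      have hsplit : ∑ x ∈ U, d x * w x = ∑ x ∈ U, d x * max (w x - w x₀) 0
          + (∑ x ∈ U with 0 < w x, d x) * w x₀ := by
        rw [sum_filter, sum_mul, ← sum_add_distrib]
        refine sum_congr rfl fun x hx => ?_
        split_ifs with hpos
        · rw [max_eq_left (sub_nonneg.2 (hle x (mem_filter.2 ⟨hx, hpos⟩)))]
          ring
        · rw [max_eq_right (by linarith [hx₀.2]), le_antisymm (not_lt.1 hpos) (hw x hx)]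
          ring
      have hcard : #{x ∈ U | 0 < max (w x - w x₀) 0} < n := by
        rw [← hn, hlevel 0 le_rfl, zero_add]
        refine card_lt_card ⟨fun x hx => ?_, fun hsub => ?_⟩
        · rw [mem_filter] at hx ⊢
          exact ⟨hx.1, hx₀.2.trans hx.2⟩
        · exact lt_irrefl _ (mem_filter.1 (hsub (mem_filter.2 hx₀))).2
      have h1 := ih _ hcard (fun x => max (w x - w x₀) 0) (fun x _ => le_max_right _ _)
        (fun t ht => by
          rw [hlevel t ht]
          exact h _ (add_nonneg ht hx₀.2.le)) rfl
      have h2 := mul_nonpos_of_nonpos_of_nonneg (h 0 le_rfl) hx₀.2.le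
      linarith

/-- If `U` is a nonempty maximal upper set w.r.t. `b` and `g•` minimizes
`J_U(g, ·)` over `I_U`, then `x ↦ max(b, g•(x))` also minimizes `J_U(g, ·)` over `I_U`. -/
theorem max_with_b_still_minimizes
    [Fintype X] [Nonempty X] [PartialOrder X]
    (ℓ : ℝ → ℝ → ℝ) (hconv : ∀ a : ℝ, ConvexOn ℝ (Set.univ : Set ℝ) (ℓ a))
    (g : X → ℝ) (b : ℝ) (U : Finset X)
    (hmax : IsMaxUpper ℓ g b U) (hUne : U.Nonempty)
    (gdot : X → ℝ) (hiso : IsotonicOn gdot U)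
    (hmin : ∀ h : X → ℝ, IsotonicOn h U → lossJ ℓ g U gdot ≤ lossJ ℓ g U h) :
    IsotonicOn (fun x => max b (gdot x)) U ∧
      ∀ h : X → ℝ, IsotonicOn h U →
        lossJ ℓ g U (fun x => max b (gdot x)) ≤ lossJ ℓ g U h := by
  refine ⟨fun x hx y hy hxy => max_le_max le_rfl (hiso x hx y hy hxy),
    fun h hh => le_trans ?_ (hmin h hh)⟩
  choose d hd using fun x => exists_isGreatest_subdiff ℓ (g x) b (hconv (g x))
  have hsum : ∑ x ∈ U, d x * max (b - gdot x) 0 ≤ 0 := by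
    refine sum_mul_nonpos_of_superlevel U d _ (fun x _ => le_max_right _ _) fun t ht => ?_
    have hup : IsUpperFinset {x ∈ U | ¬ t < max (b - gdot x) 0} := by
      intro x hx y hxy
      rw [mem_filter] at hx ⊢
      have hyU := hmax.1 x hx.1 y hxy
      refine ⟨hyU, fun hlt => hx.2 (hlt.trans_le (max_le_max ?_ le_rfl))⟩
      linarith [hiso x hx.1 y hyU hxy]
    have h1 := hmax.2 _ hup
    rw [sInf_SigmaSet_eq ℓ g b d hd, sInf_SigmaSet_eq ℓ g b d hd] at h1
    have h2 := sum_filter_add_sum_filter_not U (fun x => t < max (b - gdot x) 0) d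
    linarith
  have hpt : lossJ ℓ g U (fun x => max b (gdot x)) ≤
      lossJ ℓ g U gdot + ∑ x ∈ U, d x * max (b - gdot x) 0 := by
    rw [lossJ, lossJ, ← sum_add_distrib]
    refine sum_le_sum fun x _ => ?_
    rcases le_total b (gdot x) with hb | hb
    · simp [hb]
    · rw [max_eq_left hb, max_eq_left (sub_nonneg.2 hb)]
      linarith [(hd x).1 (gdot x)]
  linarith
end

section
/- Let b ∈ ℝ, let L be a nonempty minimal lower set of X with respect to b, and suppose g• minimizes J_L(g, ·) over I_L. Then the function x ↦ min(b, g•(x)) also minimizes J_L(g, ·) over I_L. -/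
open Pointwise Finset
open scoped Classical

variable {X : Type*}

/-- The subdifferential of a finite convex function has a least element. -/
theorem exists_isLeast_subdiff (ℓ : ℝ → ℝ → ℝ) (a b : ℝ)
    (h : ConvexOn ℝ (Set.univ : Set ℝ) (ℓ a)) : ∃ d, IsLeast (subdiff ℓ a b) d := by
  set T : Set ℝ := (fun y => (ℓ a b - ℓ a y) / (b - y)) '' Set.Iio b with hT
  have hne : T.Nonempty := ⟨_, b - 1, by simp, rfl⟩
  have hub : ∀ z, b < z → ∀ t ∈ T, t ≤ (ℓ a z - ℓ a b) / (z - b) := by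
    rintro z hz _ ⟨y, hy, rfl⟩
    exact h.slope_mono_adjacent (Set.mem_univ y) (Set.mem_univ z) hy hz
  have hbdd : BddAbove T := ⟨_, hub (b + 1) (by simp)⟩
  refine ⟨sSup T, fun y => ?_, fun s hs => csSup_le hne ?_⟩
  · rcases lt_trichotomy y b with hy | rfl | hy
    · have h1 := le_csSup hbdd (Set.mem_image_of_mem _ (Set.mem_Iio.2 hy))
      rw [div_le_iff₀ (sub_pos.2 hy)] at h1
      linarith
    · simp
    · have h1 := csSup_le hne (hub y hy)
      rw [le_div_iff₀ (sub_pos.2 hy)] at h1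
      linarith
  · rintro _ ⟨y, hy, rfl⟩
    have h1 := hs y
    rw [div_le_iff₀ (sub_pos.2 hy)]
    linarith

/-- The maximum of `Σ_b(S)` is the negated sum of the least subgradients. -/
theorem sSup_sigmaSet (ℓ : ℝ → ℝ → ℝ) (g : X → ℝ) (b : ℝ) (d : X → ℝ)
    (hd : ∀ x, IsLeast (subdiff ℓ (g x) b) (d x)) (S : Finset X) :
    sSup (SigmaSet ℓ g b S) = -∑ x ∈ S, d x := by
  refine IsGreatest.csSup_eq ⟨?_, fun s hs => ?_⟩
  · rw [SigmaSet, Set.neg_mem_neg]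
    exact Set.finsetSum_mem_finsetSum S _ _ fun x _ => (hd x).1
  · rw [SigmaSet, Set.mem_neg, Set.mem_finsetSum] at hs
    obtain ⟨f, hf, hs⟩ := hs
    have := Finset.sum_le_sum fun x hx => (hd x).2 (hf hx)
    linarith

/-- A weighted sum of a nonnegative function is nonnegative if the weights sum to a nonnegative
number over each of its strict superlevel sets. -/
theorem sum_mul_nonneg_of_superlevel_s14 (L : Finset X) (d φ : X → ℝ) (hφ : ∀ x ∈ L, 0 ≤ φ x)
    (hd : ∀ t, 0 ≤ t → 0 ≤ ∑ x ∈ L with t < φ x, d x) : 0 ≤ ∑ x ∈ L, d x * φ x := by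
  induction hn : #{x ∈ L | 0 < φ x} using Nat.strong_induction_on generalizing φ with
  | _ n ih =>
    subst hn
    rcases {x ∈ L | 0 < φ x}.eq_empty_or_nonempty with he | hne
    · refine (Finset.sum_eq_zero fun x hx => ?_).ge
      have hx0 : ¬ 0 < φ x := Finset.filter_eq_empty_iff.1 he hx
      rw [le_antisymm (not_lt.1 hx0) (hφ x hx), mul_zero]
    · obtain ⟨p, hp, hpmin⟩ := Finset.exists_min_image _ φ hne
      rw [Finset.mem_filter] at hp
      have hlevel : ∀ t, 0 ≤ t → ∀ x, t < max (φ x - φ p) 0 ↔ t + φ p < φ x := fun t ht x => by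
        rw [lt_max_iff, lt_sub_iff_add_lt, or_iff_left ht.not_gt]
      have key := ih _ (Finset.card_lt_card ?_) (fun x => max (φ x - φ p) 0)
        (fun x _ => le_max_right _ _) (fun t ht => ?_) rfl
      · have hsplit : ∑ x ∈ L, d x * φ x =
            ∑ x ∈ L, d x * max (φ x - φ p) 0 + (∑ x ∈ L with 0 < φ x, d x) * φ p := by
          rw [Finset.sum_filter, Finset.sum_mul, ← Finset.sum_add_distrib]
          refine Finset.sum_congr rfl fun x hx => ?_
          split_ifs with h
          · rw [max_eq_left (sub_nonneg.2 (hpmin x (Finset.mem_filter.2 ⟨hx, h⟩)))]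
            ring
          · rw [le_antisymm (not_lt.1 h) (hφ x hx), max_eq_right (by linarith)]
            ring
        rw [hsplit]
        exact add_nonneg key (mul_nonneg (hd 0 le_rfl) hp.2.le)
      · refine Finset.ssubset_iff_of_subset (fun x hx => ?_) |>.2 ⟨p, ?_, ?_⟩
        · rw [Finset.mem_filter, hlevel 0 le_rfl] at hx
          exact Finset.mem_filter.2 ⟨hx.1, by linarith [hp.2]⟩
        · exact Finset.mem_filter.2 hp
        · simp
      · simp only [hlevel t ht]
        exact hd _ (by linarith [hp.2])

/-- If `L` is a nonempty minimal lower set w.r.t. `b` and `g•` minimizes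
`J_L(g, ·)` over `I_L`, then `x ↦ min(b, g•(x))` also minimizes `J_L(g, ·)` over `I_L`. -/
theorem min_with_b_still_minimizes
    [Fintype X] [Nonempty X] [PartialOrder X]
    (ℓ : ℝ → ℝ → ℝ) (hconv : ∀ a : ℝ, ConvexOn ℝ (Set.univ : Set ℝ) (ℓ a))
    (g : X → ℝ) (b : ℝ) (L : Finset X)
    (hmin' : IsMinLower ℓ g b L) (hLne : L.Nonempty)
    (gdot : X → ℝ) (hiso : IsotonicOn gdot L)
    (hmin : ∀ h : X → ℝ, IsotonicOn h L → lossJ ℓ g L gdot ≤ lossJ ℓ g L h) :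
    IsotonicOn (fun x => min b (gdot x)) L ∧
      ∀ h : X → ℝ, IsotonicOn h L →
        lossJ ℓ g L (fun x => min b (gdot x)) ≤ lossJ ℓ g L h := by
  have hiso' : IsotonicOn (fun x => min b (gdot x)) L :=
    fun x hx y hy hxy => min_le_min_left b (hiso x hx y hy hxy)
  refine ⟨hiso', fun h hh => le_trans ?_ (hmin h hh)⟩
  choose d hd using fun x => exists_isLeast_subdiff ℓ (g x) b (hconv (g x))
  have hnonneg : 0 ≤ ∑ x ∈ L, d x * max (gdot x - b) 0 := by
    refine sum_mul_nonneg_of_superlevel_s14 L d _ (fun x _ => le_max_right _ _) fun t ht => ?_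
    have hlow : IsLowerFinset {x ∈ L | ¬ t < max (gdot x - b) 0} := by
      intro y hy x hxy
      rw [Finset.mem_filter] at hy ⊢
      have hx := hmin'.1 y hy.1 x hxy
      refine ⟨hx, fun hlt => hy.2 (hlt.trans_le ?_)⟩
      exact max_le_max_right 0 (sub_le_sub_right (hiso x hx y hy.1 hxy) b)
    have hle := hmin'.2 _ hlow
    rw [sSup_sigmaSet ℓ g b d hd, sSup_sigmaSet ℓ g b d hd] at hle
    have hsum := Finset.sum_filter_add_sum_filter_not L (fun x => t < max (gdot x - b) 0) d
    linarith
  have hpoint : ∀ x ∈ L,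
      ℓ (g x) (min b (gdot x)) + d x * max (gdot x - b) 0 ≤ ℓ (g x) (gdot x) := by
    intro x _
    rcases le_total b (gdot x) with hx | hx
    · rw [min_eq_left hx, max_eq_left (sub_nonneg.2 hx)]
      exact (hd x).1 (gdot x)
    · simp [min_eq_right hx, max_eq_right (sub_nonpos.2 hx)]
  have := Finset.sum_le_sum hpoint
  rw [Finset.sum_add_distrib] at this
  simp only [lossJ]
  linarith
end
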